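/- arXiv:2302.04322 — 4 statements merged into one kernel-verified Lean document; each statement's English description precedes it below -/
import Mathlib

section
/- Let c : [Q] → [K'] be any function and let ψ = ((1/√Q) Σ_{q∈[Q]} |q⟩|c(q)⟩)^{⊗k}. Then under step (1) of the uniformity test with parameters (K', Q, k, η), each answer register independently yields outcome 0 with probability exactly 1/K', and conditioned on that outcome the corresponding question register is exactly in the state |0̄⟩ = (1/√Q) Σ_q |q⟩ (so step (3) accepts with probability 1). Consequently, ψ passes the uniformity test with probability at least 1 − exp(−η²k/(2K')), which is 1 − exp(−Ω(k)) for constant η and K'. -/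
open scoped BigOperators Classical

/-- Amplitude `⟨t | F_K | s⟩` of the quantum Fourier transform on `ℂ^K`. -/
noncomputable def fourierAmp (K : ℕ) (s t : ℕ) : ℂ :=
  Complex.exp (2 * Real.pi * Complex.I * s * t / K) / Real.sqrt K

/-- Amplitude of ψ after the answer registers have been measured in the Fourier basis with
outcome `r`, as a function of the (standard-basis) question configuration `q`. -/
noncomputable def postAmp (K' Q k : ℕ) (r : Fin k → Fin K')
    (ψ : (Fin k → Fin Q) → (Fin k → Fin K') → ℂ) (q : Fin k → Fin Q) : ℂ :=
  ∑ a : Fin k → Fin K', ψ q a * ∏ i, (starRingEnd ℂ) (fourierAmp K' (r i) (a i))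

/-- Probability of obtaining Fourier-basis outcome `r` on the answer registers (step 1). -/
noncomputable def step1Prob (K' Q k : ℕ) (r : Fin k → Fin K')
    (ψ : (Fin k → Fin Q) → (Fin k → Fin K') → ℂ) : ℝ :=
  ∑ q : Fin k → Fin Q, Complex.normSq (postAmp K' Q k r ψ q)

/-- Overlap of ψ with the basis vector indexed by `(r, q̄)` used by the uniformity test. -/
noncomputable def unifOverlap (K' Q k : ℕ) (r : Fin k → Fin K') (qbar : Fin k → Fin Q)
    (ψ : (Fin k → Fin Q) → (Fin k → Fin K') → ℂ) : ℂ :=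
  ∑ q : Fin k → Fin Q, ∑ a : Fin k → Fin K',
    ψ q a * (∏ i, (starRingEnd ℂ) (fourierAmp K' (r i) (a i)))
      * (∏ i, if (r i : ℕ) = 0 then
            (starRingEnd ℂ) (fourierAmp Q 0 (q i)) * (if (qbar i : ℕ) = 0 then 1 else 0)
          else (if q i = qbar i then 1 else 0))

/-- Probability that ψ passes the uniformity test with parameters `(K', Q, k, η)`. -/
noncomputable def unifPassProb (K' Q k : ℕ) (η : ℝ)
    (ψ : (Fin k → Fin Q) → (Fin k → Fin K') → ℂ) : ℝ :=
  ∑ r : Fin k → Fin K',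
    if ((1 - η) / (K' : ℝ) * k ≤ ((Finset.univ.filter fun i => (r i : ℕ) = 0).card : ℝ)) then
      ∑ qbar : Fin k → Fin Q, Complex.normSq (unifOverlap K' Q k r qbar ψ)
    else 0

/-- The honest state `((1/√Q) Σ_q |q⟩|c(q)⟩)^{⊗ k}`. -/
noncomputable def honestState (K' Q k : ℕ) (c : Fin Q → Fin K') :
    (Fin k → Fin Q) → (Fin k → Fin K') → ℂ :=
  fun q a => ∏ i, ((Real.sqrt Q : ℂ))⁻¹ * (if a i = c (q i) then 1 else 0)

theorem normSq_fourierAmp (K s t : ℕ) : Complex.normSq (fourierAmp K s t) = 1 / (K : ℝ) := by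
  have h : (2 * Real.pi * Complex.I * s * t / K : ℂ)
      = ((2 * Real.pi * s * t / K : ℝ) : ℂ) * Complex.I := by
    push_cast
    ring
  rw [fourierAmp, h, Complex.normSq_div, Complex.normSq_eq_norm_sq, Complex.norm_exp_ofReal_mul_I,
    Complex.normSq_ofReal, Real.mul_self_sqrt (Nat.cast_nonneg K), one_pow]

theorem fourierAmp_zero_left (K t : ℕ) : fourierAmp K 0 t = ((Real.sqrt K : ℂ))⁻¹ := by
  simp [fourierAmp]

theorem normSq_inv_sqrt (n : ℕ) :
    Complex.normSq ((Real.sqrt n : ℂ))⁻¹ = 1 / (n : ℝ) := by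
  rw [← fourierAmp_zero_left n 0, normSq_fourierAmp]

theorem sum_prod_apply {k n : ℕ} {R : Type*} [CommSemiring R] (f : Fin k → Fin n → R) :
    ∑ x : Fin k → Fin n, ∏ i, f i (x i) = ∏ i, ∑ j, f i j := by
  rw [Finset.prod_univ_sum, Fintype.piFinset_univ]

theorem postAmp_honestState (K' Q k : ℕ) (c : Fin Q → Fin K') (r : Fin k → Fin K')
    (q : Fin k → Fin Q) :
    postAmp K' Q k r (honestState K' Q k c) q =
      ∏ i, ((Real.sqrt Q : ℂ))⁻¹ * (starRingEnd ℂ) (fourierAmp K' (r i) (c (q i))) := by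
  simp only [postAmp, honestState, ← Finset.prod_mul_distrib]
  rw [sum_prod_apply fun i j => ((Real.sqrt Q : ℂ))⁻¹ * (if j = c (q i) then 1 else 0) *
    (starRingEnd ℂ) (fourierAmp K' (r i) j)]
  refine Finset.prod_congr rfl fun i _ => ?_
  rw [Finset.sum_eq_single (c (q i))]
  · simp
  · intro b _ hb
    simp [hb]
  · simp

theorem step1Prob_honestState (K' Q k : ℕ) (hQ : 0 < Q) (c : Fin Q → Fin K')
    (r : Fin k → Fin K') :
    step1Prob K' Q k r (honestState K' Q k c) = ∏ _i : Fin k, (1 / (K' : ℝ)) := by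
  have hQ' : (Q : ℝ) ≠ 0 := by positivity
  simp only [step1Prob, postAmp_honestState, map_prod, Complex.normSq_mul, Complex.normSq_conj,
    normSq_fourierAmp, normSq_inv_sqrt]
  rw [sum_prod_apply fun (_ : Fin k) (_ : Fin Q) => 1 / (Q : ℝ) * (1 / (K' : ℝ))]
  refine Finset.prod_congr rfl fun i _ => ?_
  simp only [Finset.sum_const, Finset.card_univ, Fintype.card_fin, nsmul_eq_mul]
  field_simp

theorem postAmp_honestState_factor (K' Q k : ℕ) (c : Fin Q → Fin K') (r : Fin k → Fin K') :
    ∃ φ : (Fin k → Fin Q) → ℂ,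
      (∀ q q' : Fin k → Fin Q, (∀ i, (r i : ℕ) ≠ 0 → q i = q' i) → φ q = φ q') ∧
      (∀ q : Fin k → Fin Q,
        postAmp K' Q k r (honestState K' Q k c) q =
          ((Real.sqrt Q : ℂ))⁻¹ ^ ((Finset.univ.filter fun i => (r i : ℕ) = 0).card) * φ q) := by
  refine ⟨fun q => ∏ i, (if (r i : ℕ) = 0 then 1 else ((Real.sqrt Q : ℂ))⁻¹) *
    (starRingEnd ℂ) (fourierAmp K' (r i) (c (q i))), fun q q' h => ?_, fun q => ?_⟩
  · refine Finset.prod_congr rfl fun i _ => ?_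
    by_cases hi : (r i : ℕ) = 0
    · simp only [hi, fourierAmp_zero_left]
    · rw [h i hi]
  · rw [postAmp_honestState, ← Finset.prod_const, Finset.prod_filter, ← Finset.prod_mul_distrib]
    refine Finset.prod_congr rfl fun i _ => ?_
    split_ifs <;> ring

theorem unifOverlap_honestState (K' Q k : ℕ) (hQ : 0 < Q) (c : Fin Q → Fin K')
    (r : Fin k → Fin K') (qbar : Fin k → Fin Q) :
    unifOverlap K' Q k r qbar (honestState K' Q k c) =
      ∏ i, if (r i : ℕ) = 0 then ((Real.sqrt K' : ℂ))⁻¹ * (if (qbar i : ℕ) = 0 then 1 else 0)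
        else ((Real.sqrt Q : ℂ))⁻¹ * (starRingEnd ℂ) (fourierAmp K' (r i) (c (qbar i))) := by
  have hpost : unifOverlap K' Q k r qbar (honestState K' Q k c) =
      ∑ q : Fin k → Fin Q, postAmp K' Q k r (honestState K' Q k c) q *
        ∏ i, if (r i : ℕ) = 0 then
            (starRingEnd ℂ) (fourierAmp Q 0 (q i)) * (if (qbar i : ℕ) = 0 then 1 else 0)
          else (if q i = qbar i then 1 else 0) := by
    simp only [unifOverlap, postAmp, Finset.sum_mul]
  rw [hpost]
  simp only [postAmp_honestState, ← Finset.prod_mul_distrib]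
  rw [sum_prod_apply fun i j => ((Real.sqrt Q : ℂ))⁻¹ *
    (starRingEnd ℂ) (fourierAmp K' (r i) (c j)) * (if (r i : ℕ) = 0 then
            (starRingEnd ℂ) (fourierAmp Q 0 j) * (if (qbar i : ℕ) = 0 then 1 else 0)
          else (if j = qbar i then 1 else 0))]
  refine Finset.prod_congr rfl fun i _ => ?_
  by_cases hi : (r i : ℕ) = 0
  · have hs : (Real.sqrt Q : ℂ) * Real.sqrt Q = Q := by
      rw [← Complex.ofReal_mul, Real.mul_self_sqrt (Nat.cast_nonneg Q), Complex.ofReal_natCast]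
    have h0 : (Real.sqrt Q : ℂ) ≠ 0 := by
      rw [Complex.ofReal_ne_zero]
      positivity
    simp only [hi, if_true, fourierAmp_zero_left, map_inv₀, Complex.conj_ofReal,
      Finset.sum_const, Finset.card_univ, Fintype.card_fin, nsmul_eq_mul]
    rw [← hs]
    field_simp
  · simp only [hi, if_false]
    rw [Finset.sum_eq_single (qbar i)]
    · simp
    · intro b _ hb
      simp [hb]
    · simp

theorem sum_normSq_unifOverlap_honestState (K' Q k : ℕ) (hQ : 0 < Q)
    (c : Fin Q → Fin K') (r : Fin k → Fin K') :
    ∑ qbar : Fin k → Fin Q, Complex.normSq (unifOverlap K' Q k r qbar (honestState K' Q k c)) =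
      (1 / (K' : ℝ)) ^ k := by
  have hQ' : (Q : ℝ) ≠ 0 := by positivity
  simp only [unifOverlap_honestState K' Q k hQ c r, map_prod]
  rw [sum_prod_apply fun i j => Complex.normSq (if (r i : ℕ) = 0 then
    ((Real.sqrt K' : ℂ))⁻¹ * (if (j : ℕ) = 0 then 1 else 0)
    else ((Real.sqrt Q : ℂ))⁻¹ * (starRingEnd ℂ) (fourierAmp K' (r i) (c j)))]
  rw [Finset.prod_eq_pow_card (b := 1 / (K' : ℝ)), Finset.card_univ, Fintype.card_fin]
  intro i _
  by_cases hi : (r i : ℕ) = 0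
  · simp only [hi, if_true]
    rw [Finset.sum_eq_single (⟨0, hQ⟩ : Fin Q)]
    · simp only [if_true, mul_one, normSq_inv_sqrt]
    · intro b _ hb
      have : (b : ℕ) ≠ 0 := fun h => hb (Fin.ext h)
      simp [this]
    · simp
  · simp only [hi, if_false, Complex.normSq_mul, Complex.normSq_conj, normSq_fourierAmp,
      normSq_inv_sqrt, Finset.sum_const, Finset.card_univ, Fintype.card_fin, nsmul_eq_mul]
    field_simp

theorem exp_neg_le_quadratic {x : ℝ} (hx : 0 ≤ x) : Real.exp (-x) ≤ 1 - x + x ^ 2 / 2 := by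
  have h1 := Real.quadratic_le_exp_of_nonneg hx
  have h2 : 0 < 1 - x + x ^ 2 / 2 := by nlinarith [sq_nonneg (x - 1)]
  rw [Real.exp_neg, inv_le_iff_one_le_mul₀ (Real.exp_pos x)]
  nlinarith [mul_le_mul_of_nonneg_left h1 h2.le, sq_nonneg (x ^ 2)]

theorem sum_exp_neg_card_zero (K k : ℕ) (hK : 0 < K) (t : ℝ) :
    ∑ r : Fin k → Fin K, (1 / (K : ℝ)) ^ k *
        Real.exp (-t * ((Finset.univ.filter fun i => (r i : ℕ) = 0).card : ℝ)) =
      (1 - 1 / (K : ℝ) * (1 - Real.exp (-t))) ^ k := by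
  have hK' : (K : ℝ) ≠ 0 := by positivity
  have hr : ∀ r : Fin k → Fin K, (1 / (K : ℝ)) ^ k *
        Real.exp (-t * ((Finset.univ.filter fun i => (r i : ℕ) = 0).card : ℝ)) =
      ∏ i, 1 / (K : ℝ) * (if (r i : ℕ) = 0 then Real.exp (-t) else 1) := by
    intro r
    rw [Finset.prod_mul_distrib, ← Finset.prod_filter, Finset.prod_const, Finset.prod_const,
      Finset.card_univ, Fintype.card_fin, ← Real.exp_nat_mul, mul_comm (-t)]
  simp only [hr]
  rw [sum_prod_apply fun (_ : Fin k) (j : Fin K) =>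
      1 / (K : ℝ) * (if (j : ℕ) = 0 then Real.exp (-t) else 1),
    Finset.prod_const, Finset.card_univ, Fintype.card_fin]
  congr 1
  have hj : ∀ j : Fin K, (if (j : ℕ) = 0 then Real.exp (-t) else 1) =
      1 - (if j = ⟨0, hK⟩ then 1 - Real.exp (-t) else 0) := by
    intro j
    by_cases h : (j : ℕ) = 0
    · simp [h, Fin.ext_iff]
    · simp [h, Fin.ext_iff]
  rw [← Finset.mul_sum]
  simp only [hj, Finset.sum_sub_distrib, Finset.sum_ite_eq', Finset.mem_univ, if_true,
    Finset.sum_const, Finset.card_univ, Fintype.card_fin, nsmul_eq_mul]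
  field_simp

/-- The multiplicative Chernoff bound for the lower tail of the number of zeros in a uniformly
random word of length `k` over an alphabet of size `K`. -/
theorem chernoff_card_zero (K k : ℕ) (hK : 0 < K) (η : ℝ) (hη : 0 ≤ η) :
    1 - Real.exp (-(η ^ 2 * (k : ℝ)) / (2 * (K : ℝ))) ≤
      ∑ r : Fin k → Fin K,
        if ((1 - η) / (K : ℝ) * k ≤ ((Finset.univ.filter fun i => (r i : ℕ) = 0).card : ℝ)) then
          (1 / (K : ℝ)) ^ k else 0 := by
  have hK' : (0 : ℝ) < K := by positivity
  set T : ℝ := (1 - η) / (K : ℝ) * k with hT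
  have hone : ∑ _r : Fin k → Fin K, (1 / (K : ℝ)) ^ k = 1 := by
    rw [Finset.sum_const, Finset.card_univ, Fintype.card_fun, Fintype.card_fin, Fintype.card_fin,
      nsmul_eq_mul, Nat.cast_pow, ← mul_pow, mul_one_div_cancel hK'.ne', one_pow]
  have hmgf : Real.exp (η * T) * (1 - 1 / (K : ℝ) * (1 - Real.exp (-η))) ^ k ≤
      Real.exp (-(η ^ 2 * (k : ℝ)) / (2 * (K : ℝ))) := by
    have hexp : 1 - 1 / (K : ℝ) * (1 - Real.exp (-η)) ≤
        Real.exp (-(1 / (K : ℝ) * (η - η ^ 2 / 2))) := by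
      have h1 := Real.add_one_le_exp (-(1 / (K : ℝ) * (η - η ^ 2 / 2)))
      have h2 : 1 / (K : ℝ) * (η - η ^ 2 / 2) ≤ 1 / (K : ℝ) * (1 - Real.exp (-η)) := by
        refine mul_le_mul_of_nonneg_left ?_ (by positivity)
        linarith [exp_neg_le_quadratic hη]
      linarith
    have hnonneg : 0 ≤ 1 - 1 / (K : ℝ) * (1 - Real.exp (-η)) := by
      have h1 : 1 / (K : ℝ) ≤ 1 := by
        rw [div_le_one hK']
        exact_mod_cast hK
      have h2 : Real.exp (-η) ≤ 1 := Real.exp_le_one_iff.2 (neg_nonpos.2 hη)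
      have h3 : 0 ≤ 1 / (K : ℝ) := by positivity
      nlinarith [Real.exp_pos (-η)]
    calc Real.exp (η * T) * (1 - 1 / (K : ℝ) * (1 - Real.exp (-η))) ^ k
        ≤ Real.exp (η * T) * Real.exp (-(1 / (K : ℝ) * (η - η ^ 2 / 2))) ^ k := by gcongr
      _ = Real.exp (-(η ^ 2 * (k : ℝ)) / (2 * (K : ℝ))) := by
        rw [← Real.exp_nat_mul, ← Real.exp_add, hT]
        congr 1
        field_simp
        ring
  calc 1 - Real.exp (-(η ^ 2 * (k : ℝ)) / (2 * (K : ℝ)))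
      ≤ 1 - Real.exp (η * T) * (1 - 1 / (K : ℝ) * (1 - Real.exp (-η))) ^ k := by linarith
    _ = ∑ r : Fin k → Fin K, ((1 / (K : ℝ)) ^ k - Real.exp (η * T) * ((1 / (K : ℝ)) ^ k *
          Real.exp (-η * ((Finset.univ.filter fun i => (r i : ℕ) = 0).card : ℝ)))) := by
      rw [Finset.sum_sub_distrib, hone, ← Finset.mul_sum, sum_exp_neg_card_zero K k hK]
    _ ≤ _ := by
      refine Finset.sum_le_sum fun r _ => ?_
      have hp : 0 ≤ (1 / (K : ℝ)) ^ k := by positivity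
      split_ifs with h
      · have := (Real.exp_pos (η * T)).le
        have : 0 ≤ Real.exp (η * T) * ((1 / (K : ℝ)) ^ k *
          Real.exp (-η * ((Finset.univ.filter fun i => (r i : ℕ) = 0).card : ℝ))) := by positivity
        linarith
      · rw [mul_left_comm, ← Real.exp_add]
        have h1 : 1 ≤ Real.exp (η * T +
            -η * ((Finset.univ.filter fun i => (r i : ℕ) = 0).card : ℝ)) := by
          rw [Real.one_le_exp_iff]
          nlinarith [mul_le_mul_of_nonneg_left (not_le.1 h).le hη]
        linarith [mul_le_mul_of_nonneg_left h1 hp]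

/-- For the honest state `ψ = ((1/√Q) Σ_q |q⟩|c(q)⟩)^{⊗k}`:
(1) the step-1 Fourier-basis outcome on the answer registers is a product distribution in which
each register yields every outcome (in particular `0`) with probability exactly `1/K'`;
(2) conditioned on any step-1 outcome `r`, each question register `i` with `r i = 0` is exactly
in the zero Fourier state `|0̄⟩` (the post-measurement amplitude factors as `(1/√Q)^{|Z|}` times a
function of the remaining coordinates), so step 3 accepts with probability 1; and consequently
(3) ψ passes the uniformity test with probability at least `1 - exp(-η²k/(2K'))`. -/
theorem honest_state_uniformity
    (K' Q k : ℕ) (hK' : 0 < K') (hQ : 0 < Q)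
    (η : ℝ) (hη0 : 0 < η) (hη1 : η < 1)
    (c : Fin Q → Fin K') :
    (∀ r : Fin k → Fin K',
        step1Prob K' Q k r (honestState K' Q k c) = ∏ _i : Fin k, (1 / (K' : ℝ))) ∧
    (∀ r : Fin k → Fin K',
        ∃ φ : (Fin k → Fin Q) → ℂ,
          (∀ q q' : Fin k → Fin Q, (∀ i, (r i : ℕ) ≠ 0 → q i = q' i) → φ q = φ q') ∧
          (∀ q : Fin k → Fin Q,
            postAmp K' Q k r (honestState K' Q k c) q =
              ((Real.sqrt Q : ℂ))⁻¹ ^ ((Finset.univ.filter fun i => (r i : ℕ) = 0).card) * φ q)) ∧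
    1 - Real.exp (-(η ^ 2 * (k : ℝ)) / (2 * (K' : ℝ)))
      ≤ unifPassProb K' Q k η (honestState K' Q k c) := by
  refine ⟨step1Prob_honestState K' Q k hQ c, postAmp_honestState_factor K' Q k c, ?_⟩
  simp only [unifPassProb, sum_normSq_unifOverlap_honestState K' Q k hQ c]
  exact chernoff_card_zero K' k hK' η hη0.le
end

section
/- Let ψ₁ and ψ₂ each pass the uniformity test with probability 1 − ν (ψ₁ with parameters (K' = K², Q = m, k, η) and ψ₂ with parameters (K' = K, Q = n, k, η)). Then the distribution 𝒟(ψ₁, ψ₂) obtained by measuring the question registers of ψ₁ and ψ₂ in the standard basis has the form 𝒟(ψ₁, ψ₂) = 𝒟^A ⊗ 𝒟^B, where for W ∈ {A, B}, 𝒟^W admits a decomposition 𝒟^W = Σ_{T ⊆ [k], |T| ≥ (k/K')(1−η)} p^W(T) · 𝒟^{unif}_T ⊗ 𝒟^{junk,W}_{T̄} + 𝒟^{error,W}, in which p^W is a probability distribution on subsets T ⊆ [k], 𝒟^{unif}_T is uniform on the coordinates in T, 𝒟^{junk,W}_{T̄} is an arbitrary distribution on the remaining coordinates, and ‖𝒟^{error,W}‖₁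 ≤ δ(ν) = O(ν^{1/4}). -/
open scoped BigOperators Classical

/-- The distribution obtained by measuring all question registers of ψ in the standard basis. -/
noncomputable def questionDist {K' Q k : ℕ}
    (ψ : (Fin k → Fin Q) → (Fin k → Fin K') → ℂ) (q : Fin k → Fin Q) : ℝ :=
  ∑ a : Fin k → Fin K', Complex.normSq (ψ q a)

/-- `μ` decomposes, up to an error term of ℓ₁-norm at most `δ`, as a mixture over subsets
`T ⊆ [k]` with `|T| ≥ (k/K')(1-η)` of (uniform on the coordinates in `T`) ⊗ (an arbitrary
distribution on the remaining coordinates). -/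
def UnifDecompApprox (K' Q k : ℕ) (η δ : ℝ) (μ : (Fin k → Fin Q) → ℝ) : Prop :=
  ∃ (p : Finset (Fin k) → ℝ) (g : Finset (Fin k) → (Fin k → Fin Q) → ℝ)
    (err : (Fin k → Fin Q) → ℝ),
    (∀ T, 0 ≤ p T) ∧
    (∑ T : Finset (Fin k), p T = 1) ∧
    (∀ T, p T ≠ 0 → ((k : ℝ) / (K' : ℝ)) * (1 - η) ≤ (T.card : ℝ)) ∧
    (∀ T q, 0 ≤ g T q) ∧
    (∀ T, ∀ q q' : Fin k → Fin Q, (∀ i, i ∉ T → q i = q' i) → g T q = g T q') ∧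
    (∀ T, p T ≠ 0 → ∑ q : Fin k → Fin Q, (1 / (Q : ℝ)) ^ T.card * g T q = 1) ∧
    (∑ q : Fin k → Fin Q, |err q| ≤ δ) ∧
    (∀ q, μ q = (∑ T : Finset (Fin k), p T * ((1 / (Q : ℝ)) ^ T.card * g T q)) + err q)

/-- The characters of `ℤ/K`, restricted to representatives, are orthonormal. -/
theorem sum_conj_fourierAmp_mul {K : ℕ} (hK : 0 < K) (a b : Fin K) :
    ∑ s : Fin K, (starRingEnd ℂ) (fourierAmp K s a) * fourierAmp K s b
      = if a = b then 1 else 0 := by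
  have hKc : (K : ℂ) ≠ 0 := by exact_mod_cast hK.ne'
  set ζ : ℂ := Complex.exp (2 * Real.pi * Complex.I * (((b : ℕ) : ℂ) - (a : ℕ)) / K) with hζ
  have hterm : ∀ s : Fin K, (starRingEnd ℂ) (fourierAmp K s a) * fourierAmp K s b
      = ζ ^ (s : ℕ) / K := by
    intro s
    have hsq : ((Real.sqrt K : ℝ) : ℂ) * ((Real.sqrt K : ℝ) : ℂ) = K := by
      rw [← Complex.ofReal_mul, Real.mul_self_sqrt (Nat.cast_nonneg K)]
      simp
    simp only [fourierAmp, map_div₀, Complex.conj_ofReal, ← Complex.exp_conj, map_mul,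
      Complex.conj_I, map_natCast, map_ofNat]
    rw [div_mul_div_comm, hsq, ← Complex.exp_add, hζ, ← Complex.exp_nat_mul]
    congr 2
    ring
  rw [Finset.sum_congr rfl fun s _ => hterm s, ← Finset.sum_div,
    Fin.sum_univ_eq_sum_range (fun s => ζ ^ s) K]
  split_ifs with hab
  · have : ζ = 1 := by simp [hζ, hab]
    simp [this, hKc]
  · have hζK : ζ ^ K = 1 := by
      rw [hζ, ← Complex.exp_nat_mul, Complex.exp_eq_one_iff]
      refine ⟨(b : ℤ) - (a : ℤ), ?_⟩
      push_cast
      field_simp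
    have hζ1 : ζ ≠ 1 := by
      intro h
      obtain ⟨j, hj⟩ := Complex.exp_eq_one_iff.mp (hζ ▸ h)
      have hj' : ((b : ℕ) : ℂ) - (a : ℕ) = j * K := by
        have h2 := Complex.two_pi_I_ne_zero
        field_simp at hj
        apply mul_left_cancel₀ h2
        rw [hj]
        ring
      have hz : (b : ℤ) - (a : ℤ) = j * K := by exact_mod_cast hj'
      apply hab
      have hlt : |(b : ℤ) - (a : ℤ)| < K := by
        rw [abs_lt]
        omega
      have h0 := Int.eq_zero_of_abs_lt_dvd ⟨j, by rw [hz, mul_comm]⟩ hlt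
      ext
      omega
    rw [geom_sum_eq hζ1, hζK]
    simp

theorem sum_conj_prod_mul_prod {k : ℕ} {α : Type*} [Fintype α] (u v : Fin k → α → ℂ) :
    ∑ r : Fin k → α, (starRingEnd ℂ) (∏ i, u i (r i)) * ∏ i, v i (r i)
      = ∏ i, ∑ s, (starRingEnd ℂ) (u i s) * v i s := by
  rw [Fintype.prod_sum]
  simp only [map_prod, Finset.prod_mul_distrib]

theorem prod_ite_eq_apply {k : ℕ} {α : Type*} [DecidableEq α] (a b : Fin k → α) :
    (∏ i, if a i = b i then (1 : ℂ) else 0) = if a = b then 1 else 0 := by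
  rw [Finset.prod_ite_zero]
  simp [funext_iff]

/-- A family of vectors `m · b` with Gram matrix `diag z` gives an orthogonal projection `P`
of `f`, expressed through the overlaps `c b`. -/
theorem sum_normSq_of_gram {α β : Type*} [Fintype α] [Fintype β] [DecidableEq β] (m : α → β → ℂ) (z : β → ℂ)
    (hgram : ∀ b b', ∑ q, m q b * (starRingEnd ℂ) (m q b') = if b = b' then z b else 0)
    (hz : ∀ q b, z b * m q b = m q b) (f : α → ℂ) :
    (∑ q, Complex.normSq (∑ b, (∑ q', f q' * m q' b) * (starRingEnd ℂ) (m q b))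
        = ∑ b, Complex.normSq (∑ q', f q' * m q' b)) ∧
    ∑ q, Complex.normSq (f q - ∑ b, (∑ q', f q' * m q' b) * (starRingEnd ℂ) (m q b))
      = ∑ q, Complex.normSq (f q) - ∑ b, Complex.normSq (∑ q', f q' * m q' b) := by
  set c : β → ℂ := fun b => ∑ q', f q' * m q' b with hc
  set P : α → ℂ := fun q => ∑ b, c b * (starRingEnd ℂ) (m q b) with hP
  have hcz : ∀ b, z b * c b = c b := by
    intro b
    simp only [hc, Finset.mul_sum]
    refine Finset.sum_congr rfl fun q _ => ?_
    rw [mul_left_comm, hz]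
  have hmP : ∀ b, ∑ q, P q * m q b = c b := by
    intro b
    simp only [hP, Finset.sum_mul]
    rw [Finset.sum_comm]
    have : ∀ b', ∑ q, c b' * (starRingEnd ℂ) (m q b') * m q b
        = if b = b' then z b * c b' else 0 := by
      intro b'
      rw [← ite_zero_mul, ← hgram, Finset.sum_mul]
      exact Finset.sum_congr rfl fun q _ => by ring
    simp only [this, Finset.sum_ite_eq, Finset.mem_univ, if_true, hcz]
  have hinner : ∀ g : α → ℂ, ∑ q, g q * (starRingEnd ℂ) (P q)
      = ∑ b, (∑ q, g q * m q b) * (starRingEnd ℂ) (c b) := by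
    intro g
    simp only [hP, map_sum, map_mul, Complex.conj_conj, Finset.mul_sum, Finset.sum_mul]
    rw [Finset.sum_comm]
    exact Finset.sum_congr rfl fun b _ => Finset.sum_congr rfl fun q _ => by ring
  have hPP : ∑ q, P q * (starRingEnd ℂ) (P q) = ((∑ b, Complex.normSq (c b) : ℝ) : ℂ) := by
    rw [hinner]
    push_cast
    exact Finset.sum_congr rfl fun b _ => by rw [hmP, Complex.mul_conj]
  have hfP : ∑ q, f q * (starRingEnd ℂ) (P q) = ((∑ b, Complex.normSq (c b) : ℝ) : ℂ) := by
    rw [hinner]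
    push_cast
    exact Finset.sum_congr rfl fun b _ => by rw [← Complex.mul_conj]
  have h1 : ∑ q, Complex.normSq (P q) = ∑ b, Complex.normSq (c b) := by
    rw [← Complex.ofReal_inj, ← hPP]
    push_cast
    exact Finset.sum_congr rfl fun q _ => (Complex.mul_conj _).symm
  refine ⟨h1, ?_⟩
  have h2 := congrArg Complex.re hfP
  rw [Complex.re_sum, Complex.ofReal_re] at h2
  simp only [Complex.normSq_sub, Finset.sum_sub_distrib, Finset.sum_add_distrib]
  rw [← Finset.mul_sum, h1, h2]
  ring

/-- The Fourier transform of the answer registers of `ψ`. -/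
noncomputable def answerFourier {K' Q k : ℕ} (ψ : (Fin k → Fin Q) → (Fin k → Fin K') → ℂ)
    (r : Fin k → Fin K') (q : Fin k → Fin Q) : ℂ :=
  ∑ a : Fin k → Fin K', ψ q a * ∏ i, (starRingEnd ℂ) (fourierAmp K' (r i) (a i))

theorem questionDist_eq_sum_answerFourier {K' Q k : ℕ} (hK : 0 < K')
    (ψ : (Fin k → Fin Q) → (Fin k → Fin K') → ℂ) (q : Fin k → Fin Q) :
    questionDist ψ q = ∑ r, Complex.normSq (answerFourier ψ r q) := by
  symm
  have hgram : ∀ a a' : Fin k → Fin K',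
      ∑ r : Fin k → Fin K', (∏ i, (starRingEnd ℂ) (fourierAmp K' (r i) (a i))) *
        (starRingEnd ℂ) (∏ i, (starRingEnd ℂ) (fourierAmp K' (r i) (a' i)))
      = if a = a' then 1 else 0 := by
    intro a a'
    have := sum_conj_prod_mul_prod (fun i (s : Fin K') => fourierAmp K' s (a i))
      (fun i s => fourierAmp K' s (a' i))
    simp only [sum_conj_fourierAmp_mul hK, prod_ite_eq_apply] at this
    rw [← this]
    simp only [map_prod, Complex.conj_conj]
  have h : ((∑ r, Complex.normSq (answerFourier ψ r q) : ℝ) : ℂ)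
      = ((questionDist ψ q : ℝ) : ℂ) := by
    simp only [questionDist, Complex.ofReal_sum, ← Complex.mul_conj, answerFourier, map_sum]
    simp only [Finset.sum_mul_sum, map_mul]
    rw [Finset.sum_comm]
    refine Finset.sum_congr rfl fun a _ => ?_
    rw [Finset.sum_comm]
    have : ∀ a' : Fin k → Fin K', ∑ r : Fin k → Fin K',
        ψ q a * (∏ i, (starRingEnd ℂ) (fourierAmp K' (r i) (a i))) *
          ((starRingEnd ℂ) (ψ q a') *
            (starRingEnd ℂ) (∏ i, (starRingEnd ℂ) (fourierAmp K' (r i) (a' i))))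
        = if a = a' then ψ q a * (starRingEnd ℂ) (ψ q a') else 0 := by
      intro a'
      rw [← mul_boole, ← hgram, Finset.mul_sum]
      exact Finset.sum_congr rfl fun r _ => by ring
    rw [Finset.sum_congr rfl fun a' _ => this a']
    simp
  exact_mod_cast h

/-- Basis vectors of the question registers that are uniform on the coordinates in `T`. -/
noncomputable def questionTest {Q k : ℕ} (T : Finset (Fin k)) (q qbar : Fin k → Fin Q) : ℂ :=
  ∏ i, if i ∈ T then (starRingEnd ℂ) (fourierAmp Q 0 (q i)) * (if (qbar i : ℕ) = 0 then 1 else 0)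
    else (if q i = qbar i then 1 else 0)

theorem fourierAmp_zero_left_s6 (Q t : ℕ) : fourierAmp Q 0 t = ((1 / Real.sqrt Q : ℝ) : ℂ) := by
  simp [fourierAmp]

theorem questionTest_congr {Q k : ℕ} {T : Finset (Fin k)} {q q' : Fin k → Fin Q}
    (h : ∀ i, i ∉ T → q i = q' i) (qbar : Fin k → Fin Q) :
    questionTest T q qbar = questionTest T q' qbar := by
  refine Finset.prod_congr rfl fun i _ => ?_
  split_ifs <;> simp_all [fourierAmp_zero_left_s6]

theorem questionTest_gram {Q k : ℕ} (hQ : 0 < Q) (T : Finset (Fin k)) (b b' : Fin k → Fin Q) :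
    ∑ q, questionTest T q b * (starRingEnd ℂ) (questionTest T q b')
      = if b = b' then ∏ i, (if i ∈ T ∧ (b i : ℕ) ≠ 0 then (0 : ℂ) else 1) else 0 := by
  have hQc : (Q : ℂ) ≠ 0 := by exact_mod_cast hQ.ne'
  have hsq : ((Real.sqrt Q : ℝ) : ℂ) * ((Real.sqrt Q : ℝ) : ℂ) = Q := by
    rw [← Complex.ofReal_mul, Real.mul_self_sqrt (Nat.cast_nonneg Q)]
    simp
  let u : (Fin k → Fin Q) → Fin k → Fin Q → ℂ := fun b i s =>
    if i ∈ T then (starRingEnd ℂ) (fourierAmp Q 0 s) * (if (b i : ℕ) = 0 then 1 else 0)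
      else (if s = b i then 1 else 0)
  have h := sum_conj_prod_mul_prod (u b') (u b)
  have hpt : ∀ i, ∑ s, (starRingEnd ℂ) (u b' i s) * u b i s
      = (if b i = b' i then 1 else 0) * (if i ∈ T ∧ (b i : ℕ) ≠ 0 then (0 : ℂ) else 1) := by
    intro i
    by_cases hi : i ∈ T
    · by_cases h0 : (b i : ℕ) = 0 <;> by_cases h0' : (b' i : ℕ) = 0
      · have he : b i = b' i := Fin.ext (h0.trans h0'.symm)
        have hinv : (((Real.sqrt Q : ℝ) : ℂ))⁻¹ * ((Real.sqrt Q : ℝ) : ℂ)⁻¹ = (Q : ℂ)⁻¹ := by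
          rw [← mul_inv, hsq]
        have he0 : ((b' i : Fin Q) : ℕ) = 0 := h0'
        simp only [u, hi, he, he0, fourierAmp_zero_left_s6, if_true, Complex.conj_ofReal]
        simp [hinv, hQc]
      · have he : b i ≠ b' i := fun h => h0' (by rw [← h, h0])
        simp [u, hi, h0', he]
      · simp [u, hi, h0]
      · simp [u, hi, h0]
    · simp [u, hi, apply_ite (starRingEnd ℂ)]
  rw [Finset.prod_congr rfl fun i _ => hpt i, Finset.prod_mul_distrib, prod_ite_eq_apply,
    ite_mul, one_mul, zero_mul] at h
  rw [← h]
  exact Finset.sum_congr rfl fun q _ => mul_comm _ _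

theorem prod_mul_questionTest {Q k : ℕ} (T : Finset (Fin k)) (q b : Fin k → Fin Q) :
    (∏ i, (if i ∈ T ∧ (b i : ℕ) ≠ 0 then (0 : ℂ) else 1)) * questionTest T q b
      = questionTest T q b := by
  rw [questionTest, ← Finset.prod_mul_distrib]
  refine Finset.prod_congr rfl fun i _ => ?_
  split_ifs <;> simp_all

theorem unifOverlap_eq {K' Q k : ℕ} (r : Fin k → Fin K') (qbar : Fin k → Fin Q)
    (ψ : (Fin k → Fin Q) → (Fin k → Fin K') → ℂ) :
    unifOverlap K' Q k r qbar ψ = ∑ q, answerFourier ψ r q *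
      questionTest (Finset.univ.filter fun i => (r i : ℕ) = 0) q qbar := by
  simp only [unifOverlap, answerFourier, questionTest, Finset.sum_mul, Finset.mem_filter,
    Finset.mem_univ, true_and]

/-- `ℓ₁` distance of the squared moduli of two subnormalised vectors. -/
theorem sum_abs_normSq_sub_le {α : Type*} [Fintype α] (f g : α → ℂ) (ν : ℝ)
    (hf : ∑ x, Complex.normSq (f x) ≤ 1) (hg : ∑ x, Complex.normSq (g x) ≤ 1)
    (hfg : ∑ x, Complex.normSq (f x - g x) ≤ ν) :
    ∑ x, |Complex.normSq (f x) - Complex.normSq (g x)| ≤ 2 * Real.sqrt ν := by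
  simp only [Complex.normSq_eq_norm_sq] at *
  calc ∑ x, |‖f x‖ ^ 2 - ‖g x‖ ^ 2| ≤ ∑ x, ‖f x - g x‖ * (‖f x‖ + ‖g x‖) := by
        refine Finset.sum_le_sum fun x _ => ?_
        rw [sq_sub_sq, abs_mul, mul_comm, abs_of_nonneg (by positivity : 0 ≤ ‖f x‖ + ‖g x‖)]
        gcongr
        exact abs_norm_sub_norm_le _ _
    _ ≤ Real.sqrt (∑ x, ‖f x - g x‖ ^ 2) * Real.sqrt (∑ x, (‖f x‖ + ‖g x‖) ^ 2) :=
        Real.sum_mul_le_sqrt_mul_sqrt _ _ _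
    _ ≤ Real.sqrt ν * Real.sqrt (2 ^ 2) := by
        gcongr
        calc ∑ x, (‖f x‖ + ‖g x‖) ^ 2 ≤ ∑ x, (2 * ‖f x‖ ^ 2 + 2 * ‖g x‖ ^ 2) :=
              Finset.sum_le_sum fun x _ => by nlinarith [sq_nonneg (‖f x‖ - ‖g x‖)]
          _ ≤ 2 ^ 2 := by
              rw [Finset.sum_add_distrib, ← Finset.mul_sum, ← Finset.mul_sum]
              linarith
    _ = 2 * Real.sqrt ν := by rw [Real.sqrt_sq (by norm_num), mul_comm]

/-- Nonnegative functions `h T` of total mass one, each constant in the coordinates in `T` and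
supported on large `T`, normalise to a mixture of the required form. -/
theorem UnifDecompApprox.of_unnormalized {K' Q k : ℕ} (hQ : 0 < Q) {η δ : ℝ}
    {μ : (Fin k → Fin Q) → ℝ} (h : Finset (Fin k) → (Fin k → Fin Q) → ℝ)
    (h0 : ∀ T q, 0 ≤ h T q) (hsum : ∑ T, ∑ q, h T q = 1)
    (hcard : ∀ T q, h T q ≠ 0 → ((k : ℝ) / (K' : ℝ)) * (1 - η) ≤ (T.card : ℝ))
    (hconst : ∀ T, ∀ q q' : Fin k → Fin Q, (∀ i, i ∉ T → q i = q' i) → h T q = h T q')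
    (herr : ∑ q, |μ q - ∑ T, h T q| ≤ δ) :
    UnifDecompApprox K' Q k η δ μ := by
  have hQr : (Q : ℝ) ≠ 0 := by exact_mod_cast hQ.ne'
  have hcancel : ∀ T q, (1 / (Q : ℝ)) ^ T.card * ((Q : ℝ) ^ T.card * h T q / ∑ q, h T q)
      = h T q / ∑ q, h T q := by
    intro T q
    rw [one_div, inv_pow, mul_div_assoc, inv_mul_cancel_left₀ (pow_ne_zero _ hQr)]
  refine ⟨fun T => ∑ q, h T q, fun T q => (Q : ℝ) ^ T.card * h T q / ∑ q, h T q,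
    fun q => μ q - ∑ T, h T q, fun T => Finset.sum_nonneg fun q _ => h0 T q, hsum, ?_, ?_, ?_,
    ?_, herr, ?_⟩
  · intro T hT
    obtain ⟨q, -, hq⟩ := Finset.exists_ne_zero_of_sum_ne_zero hT
    exact hcard T q hq
  · intro T q
    exact div_nonneg (mul_nonneg (by positivity) (h0 T q))
      (Finset.sum_nonneg fun q _ => h0 T q)
  · intro T q q' hqq
    simp only [hconst T q q' hqq]
  · intro T hT
    simp only [hcancel]
    rw [← Finset.sum_div, div_self hT]
  · intro q
    have : ∀ T, (∑ q, h T q) * (h T q / ∑ q, h T q) = h T q := by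
      intro T
      refine mul_div_cancel_of_imp' fun hT => ?_
      exact (Finset.sum_eq_zero_iff_of_nonneg fun q _ => h0 T q).mp hT q (Finset.mem_univ q)
    simp only [hcancel, this]
    ring

/-- The state conditioned on answer outcome `r`, projected onto passing the uniformity test. -/
noncomputable def passingPart {K' Q k : ℕ} (η : ℝ)
    (ψ : (Fin k → Fin Q) → (Fin k → Fin K') → ℂ) (r : Fin k → Fin K') (q : Fin k → Fin Q) : ℂ :=
  if (1 - η) / (K' : ℝ) * k ≤ ((Finset.univ.filter fun i => (r i : ℕ) = 0).card : ℝ) then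
    ∑ b, unifOverlap K' Q k r b ψ * (starRingEnd ℂ)
      (questionTest (Finset.univ.filter fun i => (r i : ℕ) = 0) q b)
  else 0

theorem sum_normSq_passingPart {K' Q k : ℕ} (hQ : 0 < Q) (η : ℝ)
    (ψ : (Fin k → Fin Q) → (Fin k → Fin K') → ℂ) :
    ∑ r, ∑ q, Complex.normSq (passingPart η ψ r q) = unifPassProb K' Q k η ψ := by
  refine Finset.sum_congr rfl fun r _ => ?_
  simp only [passingPart]
  split_ifs
  · simp only [unifOverlap_eq]
    exact (sum_normSq_of_gram _ _ (questionTest_gram hQ _) (prod_mul_questionTest _) _).1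
  · simp

theorem sum_normSq_sub_passingPart {K' Q k : ℕ} (hQ : 0 < Q) (η : ℝ)
    (ψ : (Fin k → Fin Q) → (Fin k → Fin K') → ℂ) :
    ∑ r, ∑ q, Complex.normSq (answerFourier ψ r q - passingPart η ψ r q)
      = ∑ r, ∑ q, Complex.normSq (answerFourier ψ r q) - unifPassProb K' Q k η ψ := by
  rw [unifPassProb, ← Finset.sum_sub_distrib]
  refine Finset.sum_congr rfl fun r _ => ?_
  simp only [passingPart]
  split_ifs
  · simp only [unifOverlap_eq]
    exact (sum_normSq_of_gram _ _ (questionTest_gram hQ _) (prod_mul_questionTest _) _).2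
  · simp

theorem unifDecompApprox_questionDist {K' Q k : ℕ} (hK : 0 < K') (hQ : 0 < Q) {η : ℝ}
    (hη : 0 < η) (ψ : (Fin k → Fin Q) → (Fin k → Fin K') → ℂ)
    (hψ : ∑ q : Fin k → Fin Q, ∑ a : Fin k → Fin K', Complex.normSq (ψ q a) = 1)
    {ν : ℝ} (hν : 0 ≤ ν) (hpass : unifPassProb K' Q k η ψ = 1 - ν) :
    UnifDecompApprox K' Q k η (3 * ν ^ ((1 : ℝ) / 4)) (questionDist ψ) := by
  have hQr : (Q : ℝ) ≠ 0 := by exact_mod_cast hQ.ne'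
  have hP := (sum_normSq_passingPart hQ η ψ).trans hpass
  have hf : ∑ r, ∑ q, Complex.normSq (answerFourier ψ r q) = 1 := by
    rw [Finset.sum_comm, ← hψ]
    exact Finset.sum_congr rfl fun q _ => (questionDist_eq_sum_answerFourier hK ψ q).symm
  have hfP := sum_normSq_sub_passingPart hQ η ψ
  rw [hf, hpass] at hfP
  have hν1 : ν ≤ 1 := by
    have : 0 ≤ ∑ r, ∑ q, Complex.normSq (passingPart η ψ r q) :=
      Finset.sum_nonneg fun r _ => Finset.sum_nonneg fun q _ => Complex.normSq_nonneg _
    linarith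
  have hl1 := sum_abs_normSq_sub_le
    (fun x : (Fin k → Fin K') × (Fin k → Fin Q) => answerFourier ψ x.1 x.2)
    (fun x => passingPart η ψ x.1 x.2) ν
    (by rw [Fintype.sum_prod_type]; linarith) (by rw [Fintype.sum_prod_type]; linarith)
    (by rw [Fintype.sum_prod_type]; linarith)
  rw [Fintype.sum_prod_type, Finset.sum_comm] at hl1
  have hunif : ∑ _q : Fin k → Fin Q, ν * (1 / (Q : ℝ)) ^ k = ν := by
    simp
    field_simp
  have hroot : ∀ s : ℝ, 1 / 4 ≤ s → ν ^ s ≤ ν ^ ((1 : ℝ) / 4) := fun s hs =>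
    Real.rpow_le_rpow_of_exponent_ge' hν hν1 (by norm_num) hs
  let h : Finset (Fin k) → (Fin k → Fin Q) → ℝ := fun T q =>
    (∑ r : Fin k → Fin K', if (Finset.univ.filter fun i => (r i : ℕ) = 0) = T then
      Complex.normSq (passingPart η ψ r q) else 0)
    + if T = Finset.univ then ν * (1 / (Q : ℝ)) ^ k else 0
  have hh : ∀ q, ∑ T, h T q
      = ∑ r, Complex.normSq (passingPart η ψ r q) + ν * (1 / (Q : ℝ)) ^ k := by
    intro q
    simp only [h, Finset.sum_add_distrib]
    rw [Finset.sum_comm]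
    simp
  refine UnifDecompApprox.of_unnormalized hQ h ?_ ?_ ?_ ?_ ?_
  · intro T q
    refine add_nonneg (Finset.sum_nonneg fun r _ => ?_) ?_
    · split_ifs
      exacts [Complex.normSq_nonneg _, le_rfl]
    · split_ifs <;> positivity
  · rw [Finset.sum_comm]
    simp only [hh, Finset.sum_add_distrib, hunif]
    rw [Finset.sum_comm, hP]
    ring
  · intro T q hT
    by_cases hTu : T = Finset.univ
    · subst hTu
      rw [Finset.card_univ, Fintype.card_fin, div_mul_eq_mul_div, mul_div_assoc]
      have hK1 : (1 : ℝ) ≤ K' := by exact_mod_cast hK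
      have : (1 - η) / (K' : ℝ) ≤ 1 := (div_le_one (by linarith)).mpr (by linarith)
      exact mul_le_of_le_one_right (Nat.cast_nonneg k) this
    · simp only [h, hTu, if_false, add_zero] at hT
      obtain ⟨r, -, hr⟩ := Finset.exists_ne_zero_of_sum_ne_zero hT
      obtain ⟨hrT, hr⟩ := ite_ne_right_iff.mp hr
      rw [passingPart] at hr
      split_ifs at hr with hgood
      · rw [hrT] at hgood
        exact le_of_eq_of_le (by ring) hgood
      · simp at hr
  · intro T q q' hqq
    simp only [h]
    refine congrArg (· + _) (Finset.sum_congr rfl fun r _ => ?_)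
    split_ifs with hrT
    · simp only [passingPart, hrT, questionTest_congr hqq]
    · rfl
  · calc ∑ q : Fin k → Fin Q, |questionDist ψ q - ∑ T : Finset (Fin k), h T q|
        ≤ ∑ q : Fin k → Fin Q, (∑ r : Fin k → Fin K', |Complex.normSq (answerFourier ψ r q)
            - Complex.normSq (passingPart η ψ r q)| + ν * (1 / (Q : ℝ)) ^ k) := by
          refine Finset.sum_le_sum fun q _ => ?_
          rw [hh, questionDist_eq_sum_answerFourier hK, ← sub_sub, ← Finset.sum_sub_distrib]
          refine (abs_sub _ _).trans (add_le_add (Finset.abs_sum_le_sum_abs _ _) ?_)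
          exact (abs_of_nonneg (by positivity)).le
      _ ≤ 2 * Real.sqrt ν + ν := by
          rw [Finset.sum_add_distrib, hunif]
          linarith
      _ ≤ 3 * ν ^ ((1 : ℝ) / 4) := by
          have h1 := hroot (1 / 2) (by norm_num)
          have h2 := hroot 1 (by norm_num)
          rw [← Real.sqrt_eq_rpow] at h1
          rw [Real.rpow_one] at h2
          linarith

/-- If `ψ1` passes the uniformity test with parameters `(K², m, k, η)` and `ψ2`
passes it with parameters `(K, n, k, η)`, each with probability `1 - ν`, then the distribution
obtained by measuring the question registers of `ψ1` and `ψ2` in the standard basis is the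
product `𝒟^A ⊗ 𝒟^B`, and each factor decomposes as a mixture of (uniform on a large subset
`T`) ⊗ (junk) plus an error term of ℓ₁-norm `O(ν^{1/4})`. -/
theorem measured_question_distribution_decomposition :
    ∃ C : ℝ, 0 < C ∧
      ∀ (K n m k : ℕ), 0 < K → 0 < n → 0 < m →
      ∀ (η : ℝ), 0 < η → η < 1 →
      ∀ (ψ1 : (Fin k → Fin m) → (Fin k → Fin (K * K)) → ℂ)
        (ψ2 : (Fin k → Fin n) → (Fin k → Fin K) → ℂ),
        (∑ q : Fin k → Fin m, ∑ a : Fin k → Fin (K * K), Complex.normSq (ψ1 q a) = 1) →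
        (∑ q : Fin k → Fin n, ∑ a : Fin k → Fin K, Complex.normSq (ψ2 q a) = 1) →
      ∀ (ν : ℝ), 0 ≤ ν →
        unifPassProb (K * K) m k η ψ1 = 1 - ν →
        unifPassProb K n k η ψ2 = 1 - ν →
        (∀ (x : Fin k → Fin m) (y : Fin k → Fin n),
            (∑ a : Fin k → Fin (K * K), ∑ b : Fin k → Fin K,
                Complex.normSq (ψ1 x a * ψ2 y b))
              = questionDist ψ1 x * questionDist ψ2 y) ∧
        UnifDecompApprox (K * K) m k η (C * ν ^ ((1 : ℝ) / 4)) (questionDist ψ1) ∧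
        UnifDecompApprox K n k η (C * ν ^ ((1 : ℝ) / 4)) (questionDist ψ2) := by
  refine ⟨3, by norm_num, ?_⟩
  intro K n m k hK hn hm η hη _ ψ1 ψ2 h1 h2 ν hν hp1 hp2
  refine ⟨fun x y => ?_, unifDecompApprox_questionDist (Nat.mul_pos hK hK) hm hη ψ1 h1 hν hp1,
    unifDecompApprox_questionDist hK hn hη ψ2 h2 hν hp2⟩
  simp only [questionDist, Complex.normSq_mul, Finset.sum_mul_sum]
end

section
/- Let 𝒟 = 𝒟^A ⊗ 𝒟^B be a product distribution over question pairs of the consistency game G^{k,ℓ}(𝒢, K, R), where 𝒟^A = Σ_{T ⊆ [k], |T| = k'} p^A(T) · 𝒟^{unif}_T ⊗ 𝒟^{junk,A}_{T̄} and 𝒟^B = Σ_{T ⊆ [ℓ], |T| = ℓ'} p^B(T) · 𝒟^{unif}_T ⊗ 𝒟^{junk,B}_{T̄}, with k' ≤ k, ℓ' ≤ ℓ, p^A, p^B probability distributions over subsets, 𝒟^{unif}_T uniform on the coordinates in T, and 𝒟^{junk}_{T̄} arbitrary distributions on the remaining coordinates. Then ω(G^{k,ℓ}(𝒢,K,R)|_𝒟)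 ≤ ω(G^{k',ℓ'}(𝒢,K,R)). -/
open scoped BigOperators Classical

/-- The payoff of the deterministic strategy `(f, g)` in the two-player game with question
distribution `μ` and decision predicate `D`. -/
noncomputable def stratValue {X Y A B : Type*} [Fintype X] [Fintype Y]
    (μ : X → Y → ℝ) (D : X → Y → A → B → Prop)
    (f : X → A) (g : Y → B) : ℝ :=
  ∑ x : X, ∑ y : Y, μ x y * (if D x y (f x) (g y) then 1 else 0)

/-- The classical value of the two-player game with question distribution `μ` and decision
predicate `D` (the supremum over classical strategies of the expected payoff). -/
noncomputable def gameValue {X Y A B : Type*} [Fintype X] [Fintype Y] [Fintype A] [Fintype B]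
    (μ : X → Y → ℝ) (D : X → Y → A → B → Prop) : ℝ :=
  ⨆ fg : (X → A) × (Y → B), stratValue μ D fg.1 fg.2

/-- The uniform distribution over pairs of questions. -/
noncomputable def uniformPair (X Y : Type*) [Fintype X] [Fintype Y] : X → Y → ℝ :=
  fun _ _ => ((Fintype.card X : ℝ) * (Fintype.card Y : ℝ))⁻¹

/-- The consistency-test acceptance predicate: for every Alice edge `qA i` and Bob vertex `qB j`
with `qB j ∈ qA i`, Alice's and Bob's colourings of that vertex agree and the colours Alice
assigns to the endpoints of the edge satisfy `R`. -/
def consisAccept {n m K k l : ℕ} (ends : Fin m → Fin n × Fin n)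
    (R : Fin m → Fin K → Fin K → Bool)
    (qA : Fin k → Fin m) (qB : Fin l → Fin n)
    (aA : Fin k → Fin K × Fin K) (aB : Fin l → Fin K) : Prop :=
  ∀ (i : Fin k) (j : Fin l),
    (((ends (qA i)).1 = qB j ∨ (ends (qA i)).2 = qB j) →
        R (qA i) (aA i).1 (aA i).2 = true) ∧
    ((ends (qA i)).1 = qB j → (aA i).1 = aB j) ∧
    ((ends (qA i)).2 = qB j → (aA i).2 = aB j)

/-- Overwriting the coordinates in the range of `e` of a tuple by a fresh tuple is measure
preserving up to the number of fresh tuples. -/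
theorem sum_sum_extend {ι κ α : Type*} [Fintype ι] [Fintype κ] [Fintype α]
    [DecidableEq ι] [DecidableEq κ] {e : ι → κ} (he : Function.Injective e) (H : (κ → α) → ℝ) :
    ∑ r : κ → α, ∑ q : ι → α, H (Function.extend e q r)
      = (Fintype.card α : ℝ) ^ Fintype.card ι * ∑ r : κ → α, H r := by
  have hinv : Function.Involutive
      (fun z : (κ → α) × (ι → α) => (Function.extend e z.2 z.1, z.1 ∘ e)) := by
    rintro ⟨r, q⟩
    refine Prod.ext (funext fun j => ?_) (funext fun i => he.extend_apply _ _ _)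
    by_cases hj : ∃ i, e i = j
    · obtain ⟨i, rfl⟩ := hj
      simp [he.extend_apply]
    · simp [Function.extend_apply' _ _ _ hj]
  rw [← Fintype.sum_prod_type' (fun r q => H (Function.extend e q r))]
  refine (Equiv.sum_comp hinv.toPerm (fun z => H z.1)).trans ?_
  rw [Fintype.sum_prod_type' (fun r _ => H r)]
  simp [Finset.mul_sum]

/-- A mixture of distributions that are uniform on `k'` of the `k` coordinates can be sampled by
planting a uniformly random `k'`-tuple in a random environment. -/
theorem exists_planting {k k' m : ℕ} (hm : 0 < m) (hk' : k' ≤ k)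
    (D : (Fin k → Fin m) → ℝ) (p : Finset (Fin k) → ℝ)
    (g : Finset (Fin k) → (Fin k → Fin m) → ℝ)
    (hp0 : ∀ T, 0 ≤ p T) (hp1 : ∑ T, p T = 1) (hpcard : ∀ T, p T ≠ 0 → T.card = k')
    (hg0 : ∀ T q, 0 ≤ g T q)
    (hgdep : ∀ T, ∀ q q' : Fin k → Fin m, (∀ i, i ∉ T → q i = q' i) → g T q = g T q')
    (hgsum : ∀ T, p T ≠ 0 → ∑ q : Fin k → Fin m, (1 / (m : ℝ)) ^ T.card * g T q = 1)
    (hD : ∀ q, D q = ∑ T, p T * ((1 / (m : ℝ)) ^ T.card * g T q)) :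
    ∃ (w : Finset (Fin k) × (Fin k → Fin m) → ℝ)
      (e : Finset (Fin k) × (Fin k → Fin m) → Fin k' → Fin k)
      (φ : Finset (Fin k) × (Fin k → Fin m) → (Fin k' → Fin m) → Fin k → Fin m),
      (∀ i, 0 ≤ w i) ∧ ∑ i, w i = 1 ∧ (∀ i q t, φ i q (e i t) = q t) ∧
      ∀ F : (Fin k → Fin m) → ℝ,
        ∑ q, D q * F q = ∑ i, w i * (((m : ℝ) ^ k')⁻¹ * ∑ q, F (φ i q)) := by
  have hemb (T : Finset (Fin k)) : ∃ e : Fin k' → Fin k,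
      Function.Injective e ∧ (T.card = k' → ∀ i, e i ∈ T) := by
    by_cases hT : T.card = k'
    · exact ⟨T.orderEmbOfFin hT, (T.orderEmbOfFin hT).injective,
        fun _ i => T.orderEmbOfFin_mem hT i⟩
    · exact ⟨Fin.castLE hk', Fin.castLE_injective hk', fun h => absurd h hT⟩
  choose e he hmem using hemb
  have hm0 : (m : ℝ) ≠ 0 := by positivity
  refine ⟨fun z => p z.1 * ((1 / (m : ℝ)) ^ z.1.card * g z.1 z.2), fun z => e z.1,
    fun z q => Function.extend (e z.1) q z.2, fun z => ?_, ?_,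
    fun z q t => (he z.1).extend_apply _ _ _, fun F => ?_⟩
  · have := hp0 z.1
    have := hg0 z.1 z.2
    positivity
  · rw [Fintype.sum_prod_type]
    refine (Finset.sum_congr rfl fun T _ => ?_).trans hp1
    simp only [← Finset.mul_sum]
    by_cases hT : p T = 0
    · simp [hT]
    · rw [Finset.mul_sum, hgsum T hT, mul_one]
  · simp_rw [hD, Finset.sum_mul]
    rw [Finset.sum_comm, Fintype.sum_prod_type]
    refine Finset.sum_congr rfl fun T _ => ?_
    by_cases hT : p T = 0
    · simp [hT]
    have hcongr (r : Fin k → Fin m) (q : Fin k' → Fin m) :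
        g T r = g T (Function.extend (e T) q r) := by
      refine hgdep T _ _ fun j hj => (Function.extend_apply' _ _ _ ?_).symm
      rintro ⟨i, rfl⟩
      exact hj (hmem T (hpcard T hT) i)
    have key := sum_sum_extend (he T) (fun q => g T q * F q)
    simp_rw [← hcongr, ← Finset.mul_sum, Fintype.card_fin] at key
    calc ∑ q, p T * ((1 / (m : ℝ)) ^ T.card * g T q) * F q
        = p T * (1 / (m : ℝ)) ^ T.card * ∑ q, g T q * F q := by
          rw [Finset.mul_sum]
          exact Finset.sum_congr rfl fun _ _ => by ring
      _ = p T * (1 / (m : ℝ)) ^ T.card * (((m : ℝ) ^ k')⁻¹ *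
            ((m : ℝ) ^ k' * ∑ q, g T q * F q)) := by
          rw [inv_mul_cancel_left₀ (pow_ne_zero _ hm0)]
      _ = _ := by
          rw [← key, Finset.mul_sum, Finset.mul_sum]
          exact Finset.sum_congr rfl fun _ _ => by ring

theorem stratValue_le_gameValue {X Y A B : Type*} [Fintype X] [Fintype Y] [Fintype A] [Fintype B]
    (μ : X → Y → ℝ) (D : X → Y → A → B → Prop) (f : X → A) (g : Y → B) :
    stratValue μ D f g ≤ gameValue μ D :=
  le_ciSup (f := fun fg : (X → A) × (Y → B) => stratValue μ D fg.1 fg.2)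
    (Set.finite_range _).bddAbove (f, g)

/-- Acceptance of large tuples implies acceptance of subtuples. -/
theorem consisAccept.comp {n m K k l k' l' : ℕ} {ends : Fin m → Fin n × Fin n}
    {R : Fin m → Fin K → Fin K → Bool} {qA : Fin k → Fin m} {qB : Fin l → Fin n}
    {aA : Fin k → Fin K × Fin K} {aB : Fin l → Fin K}
    (h : consisAccept ends R qA qB aA aB) (d : Fin k' → Fin k) (e : Fin l' → Fin l) :
    consisAccept ends R (qA ∘ d) (qB ∘ e) (aA ∘ d) (aB ∘ e) :=
  fun i j => h (d i) (e j)

/-- If `𝒟 = 𝒟^A ⊗ 𝒟^B` where `𝒟^A` (resp. `𝒟^B`) is a mixture over subsets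
`T` of size `k'` (resp. `ℓ'`) of (uniform on the coordinates in `T`) ⊗ (arbitrary junk on the
remaining coordinates), then `ω(G^{k,ℓ}(𝒢,K,R)|_𝒟) ≤ ω(G^{k',ℓ'}(𝒢,K,R))`. -/
theorem consistency_game_discard_questions
    (n m K k l k' l' : ℕ) (hn : 0 < n) (hm : 0 < m) (hK : 0 < K)
    (hk' : k' ≤ k) (hl' : l' ≤ l)
    (ends : Fin m → Fin n × Fin n) (R : Fin m → Fin K → Fin K → Bool)
    (DA : (Fin k → Fin m) → ℝ) (DB : (Fin l → Fin n) → ℝ)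
    (pA : Finset (Fin k) → ℝ) (gA : Finset (Fin k) → (Fin k → Fin m) → ℝ)
    (pB : Finset (Fin l) → ℝ) (gB : Finset (Fin l) → (Fin l → Fin n) → ℝ)
    (hpA0 : ∀ T, 0 ≤ pA T) (hpA1 : ∑ T : Finset (Fin k), pA T = 1)
    (hpAcard : ∀ T, pA T ≠ 0 → T.card = k')
    (hgA0 : ∀ T q, 0 ≤ gA T q)
    (hgAdep : ∀ T, ∀ q q' : Fin k → Fin m, (∀ i, i ∉ T → q i = q' i) → gA T q = gA T q')
    (hgAsum : ∀ T, pA T ≠ 0 →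
      ∑ q : Fin k → Fin m, (1 / (m : ℝ)) ^ T.card * gA T q = 1)
    (hDA : ∀ q, DA q = ∑ T : Finset (Fin k), pA T * ((1 / (m : ℝ)) ^ T.card * gA T q))
    (hpB0 : ∀ T, 0 ≤ pB T) (hpB1 : ∑ T : Finset (Fin l), pB T = 1)
    (hpBcard : ∀ T, pB T ≠ 0 → T.card = l')
    (hgB0 : ∀ T q, 0 ≤ gB T q)
    (hgBdep : ∀ T, ∀ q q' : Fin l → Fin n, (∀ i, i ∉ T → q i = q' i) → gB T q = gB T q')
    (hgBsum : ∀ T, pB T ≠ 0 →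
      ∑ q : Fin l → Fin n, (1 / (n : ℝ)) ^ T.card * gB T q = 1)
    (hDB : ∀ q, DB q = ∑ T : Finset (Fin l), pB T * ((1 / (n : ℝ)) ^ T.card * gB T q)) :
    gameValue (fun x y => DA x * DB y)
        (consisAccept (n := n) (m := m) (K := K) (k := k) (l := l) ends R)
      ≤ gameValue (uniformPair (Fin k' → Fin m) (Fin l' → Fin n))
          (consisAccept (n := n) (m := m) (K := K) (k := k') (l := l') ends R) := by
  obtain ⟨w, d, φ, hw0, hw1, hφ, hw⟩ :=
    exists_planting hm hk' DA pA gA hpA0 hpA1 hpAcard hgA0 hgAdep hgAsum hDA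
  obtain ⟨v, e, ψ, hv0, hv1, hψ, hv⟩ :=
    exists_planting hn hl' DB pB gB hpB0 hpB1 hpBcard hgB0 hgBdep hgBsum hDB
  have : Nonempty (Fin K) := ⟨⟨0, hK⟩⟩
  refine ciSup_le fun fg => ?_
  obtain ⟨f, g⟩ := fg
  set V := gameValue (uniformPair (Fin k' → Fin m) (Fin l' → Fin n))
    (consisAccept (n := n) (m := m) (K := K) (k := k') (l := l') ends R)
  let P : (Fin k → Fin m) → (Fin l → Fin n) → ℝ :=
    fun x y => if consisAccept ends R x y (f x) (g y) then 1 else 0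
  have hplant (i) (j) : ((m : ℝ) ^ k')⁻¹ * ∑ x, ((n : ℝ) ^ l')⁻¹ * ∑ y, P (φ i x) (ψ j y) ≤ V := by
    refine le_trans ?_ (stratValue_le_gameValue _ _
      (fun x => f (φ i x) ∘ d i) (fun y => g (ψ j y) ∘ e j))
    simp only [stratValue, uniformPair, Fintype.card_fun, Fintype.card_fin, Nat.cast_pow, mul_inv,
      Finset.mul_sum, ← mul_assoc]
    refine Finset.sum_le_sum fun x _ => Finset.sum_le_sum fun y _ => ?_
    refine mul_le_mul_of_nonneg_left ?_ (by positivity)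
    by_cases h : consisAccept ends R (φ i x) (ψ j y) (f (φ i x)) (g (ψ j y))
    · have h' := h.comp (d i) (e j)
      rw [show φ i x ∘ d i = x from funext (hφ i x),
        show ψ j y ∘ e j = y from funext (hψ j y)] at h'
      simp [P, h, h']
    · simp only [P, h, if_false]
      positivity
  calc stratValue (fun x y => DA x * DB y) (consisAccept ends R) f g
      = ∑ x, DA x * ∑ y, DB y * P x y := by
        simp only [stratValue, P, Finset.mul_sum, mul_assoc]
    _ = ∑ i, ∑ j, w i * v j *
          (((m : ℝ) ^ k')⁻¹ * ∑ x, ((n : ℝ) ^ l')⁻¹ * ∑ y, P (φ i x) (ψ j y)) := by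
        simp_rw [hw, hv, Finset.mul_sum]
        refine Finset.sum_congr rfl fun i _ => ?_
        rw [Finset.sum_comm]
        refine Finset.sum_congr rfl fun j _ => Finset.sum_congr rfl fun x _ =>
          Finset.sum_congr rfl fun y _ => by ring
    _ ≤ ∑ i, ∑ j, w i * v j * V :=
        Finset.sum_le_sum fun i _ => Finset.sum_le_sum fun j _ =>
          mul_le_mul_of_nonneg_left (hplant i j) (mul_nonneg (hw0 i) (hv0 j))
    _ = V := by
        simp_rw [← Finset.sum_mul, ← Finset.mul_sum, hv1, mul_one, hw1, one_mul]
end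

section
/- Let C ≥ 1 and β ≥ 1 be constants and set f(ℓ) = C (log₂ ℓ)^β. There exist constants Q₀ and G (depending only on C and β) with f(ℓ) < ℓ for all ℓ > Q₀, such that the function g defined by the recurrence g(ℓ) = 0 for ℓ ≤ Q₀ and g(ℓ) = 1 + g(f(ℓ)) for ℓ > Q₀ satisfies g(ℓ) ≤ G · log₂ log₂ log₂ ℓ for all ℓ > Q₀. -/
open Real Filter in
theorem eventually_mul_rpow_le_two_rpow_sqrt (C β : ℝ) :
    ∀ᶠ x : ℝ in atTop, C * x ^ β ≤ 2 ^ √x := by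
  have h := ((isLittleO_rpow_exp_pos_mul_atTop (2 * β)
    (log_pos one_lt_two)).const_mul_left C).bound one_pos
  filter_upwards [tendsto_sqrt_atTop.eventually h, eventually_ge_atTop 0] with x hx hx0
  have h1 : √x ^ (2 * β) = x ^ β := by
    rw [rpow_mul (sqrt_nonneg x), rpow_two, sq_sqrt hx0]
  rw [h1, one_mul, norm_of_nonneg (exp_pos _).le, ← rpow_def_of_pos two_pos] at hx
  exact (le_norm_self _).trans hx

open Real in
/-- One step of `ℓ ↦ C (log₂ ℓ) ^ β`, in terms of `x = log₂ ℓ`, lowers `log₂ log₂ log₂` by one. -/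
theorem logb_logb_logb_mul_rpow_le {C β x : ℝ} (hC : 1 ≤ C) (hβ : 1 ≤ β) (hx : 16 ≤ x)
    (h : C * x ^ β ≤ 2 ^ √x) :
    logb 2 (logb 2 (logb 2 (C * x ^ β))) ≤ logb 2 (logb 2 x) - 1 := by
  have hx0 : 0 < x := by linarith
  have hge : x ≤ C * x ^ β :=
    calc x = x ^ (1 : ℝ) := (rpow_one x).symm
      _ ≤ x ^ β := rpow_le_rpow_of_exponent_le (by linarith) hβ
      _ ≤ C * x ^ β := le_mul_of_one_le_left (by positivity) hC
  have hpos : 0 < C * x ^ β := hx0.trans_le hge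
  have h1 : 4 ≤ logb 2 (C * x ^ β) := by
    rw [le_logb_iff_rpow_le one_lt_two hpos]
    norm_num
    linarith
  have h2 : logb 2 (C * x ^ β) ≤ √x := (logb_le_iff_le_rpow one_lt_two hpos).2 h
  have h3 : 2 ≤ logb 2 (logb 2 (C * x ^ β)) := by
    rw [le_logb_iff_rpow_le one_lt_two (by linarith)]
    norm_num
    linarith
  have h4 : logb 2 (logb 2 (C * x ^ β)) ≤ logb 2 x / 2 := by
    have h5 := logb_le_logb_of_le one_lt_two (by linarith) h2
    rwa [sqrt_eq_rpow, logb_rpow_eq_mul_logb_of_pos hx0, one_div_mul_eq_div] at h5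
  have h6 := logb_le_logb_of_le one_lt_two (by linarith) h4
  rwa [logb_div (by linarith) two_ne_zero, logb_self_eq_one one_lt_two] at h6

open Real in
theorem two_rpow_sqrt_logb_le_sub_one {ℓ : ℝ} (hℓ : 2 ≤ ℓ) (hx : 16 ≤ logb 2 ℓ) :
    2 ^ √(logb 2 ℓ) ≤ ℓ - 1 := by
  have hsqrt : √(logb 2 ℓ) ≤ logb 2 ℓ - 1 := by
    rw [sqrt_le_left (by linarith)]
    nlinarith
  have h := rpow_le_rpow_of_exponent_le one_le_two hsqrt
  rw [rpow_sub two_pos, rpow_logb two_pos (by norm_num) (by linarith), rpow_one] at h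
  linarith


/-- Let `C ≥ 1`, `β ≥ 1` and `f(ℓ) = C (log₂ ℓ)^β`. There are constants `Q₀`
and `G` (depending only on `C` and `β`) such that `f(ℓ) < ℓ` for all `ℓ > Q₀`, and every
function `g` satisfying the recurrence `g(ℓ) = 0` for `ℓ ≤ Q₀` and `g(ℓ) = 1 + g(f(ℓ))` for
`ℓ > Q₀` satisfies `g(ℓ) ≤ G · log₂ log₂ log₂ ℓ` for all `ℓ > Q₀`. -/
theorem iteration_count_bound (C β : ℝ) (hC : 1 ≤ C) (hβ : 1 ≤ β) :
    ∃ Q₀ G : ℝ,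
      (∀ ℓ : ℝ, Q₀ < ℓ → C * (Real.logb 2 ℓ) ^ β < ℓ) ∧
      ∀ g : ℝ → ℝ,
        (∀ ℓ : ℝ, ℓ ≤ Q₀ → g ℓ = 0) →
        (∀ ℓ : ℝ, Q₀ < ℓ → g ℓ = 1 + g (C * (Real.logb 2 ℓ) ^ β)) →
        ∀ ℓ : ℝ, Q₀ < ℓ →
          g ℓ ≤ G * Real.logb 2 (Real.logb 2 (Real.logb 2 ℓ)) := by
  obtain ⟨x₀, hx₀⟩ := Filter.eventually_atTop.1 (eventually_mul_rpow_le_two_rpow_sqrt C β)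
  set M := max x₀ 16
  have hlog : ∀ ℓ : ℝ, (2 : ℝ) ^ M < ℓ → 2 ≤ ℓ ∧ 16 ≤ Real.logb 2 ℓ ∧
      C * (Real.logb 2 ℓ) ^ β ≤ 2 ^ √(Real.logb 2 ℓ) := by
    intro ℓ hℓ
    have hM : 16 ≤ M := le_max_right _ _
    have h2 : (2 : ℝ) ^ (1 : ℝ) ≤ 2 ^ M :=
      Real.rpow_le_rpow_of_exponent_le one_le_two (by linarith)
    rw [Real.rpow_one] at h2
    have hx : M ≤ Real.logb 2 ℓ :=
      (Real.le_logb_iff_rpow_le one_lt_two (by linarith)).2 hℓ.le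
    exact ⟨by linarith, hM.trans hx, hx₀ _ ((le_max_left _ _).trans hx)⟩
  have hdec : ∀ ℓ : ℝ, (2 : ℝ) ^ M < ℓ → C * (Real.logb 2 ℓ) ^ β ≤ ℓ - 1 := by
    intro ℓ hℓ
    obtain ⟨h2, hx, hf⟩ := hlog ℓ hℓ
    exact hf.trans (two_rpow_sqrt_logb_le_sub_one h2 hx)
  refine ⟨2 ^ M, 1, fun ℓ hℓ => by linarith [hdec ℓ hℓ], fun g hg0 hg ℓ hℓ => ?_⟩
  rw [one_mul]
  obtain ⟨n, hn⟩ := exists_nat_ge (ℓ - 2 ^ M)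
  induction n generalizing ℓ with
  | zero => norm_num at hn; linarith
  | succ n ih =>
    push_cast at hn
    obtain ⟨-, hx, hf⟩ := hlog ℓ hℓ
    rw [hg ℓ hℓ]
    rcases le_or_gt (C * (Real.logb 2 ℓ) ^ β) (2 ^ M) with hle | hlt
    · rw [hg0 _ hle]
      have h4 : 4 ≤ Real.logb 2 (Real.logb 2 ℓ) := by
        rw [Real.le_logb_iff_rpow_le one_lt_two (by linarith)]
        norm_num
        linarith
      rw [add_zero, Real.le_logb_iff_rpow_le one_lt_two (by linarith), Real.rpow_one]
      linarith
    · linarith [ih _ hlt (by linarith [hdec ℓ hℓ]), logb_logb_logb_mul_rpow_le hC hβ hx hf]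
end
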